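/- Let G be a finite connected non-bipartite simple graph on a vertex set V with at least one edge, so every vertex has positive degree. Let P be the simple random walk transition matrix and π the degree-proportional distribution. Then for every initial probability distribution π₀ on V (π₀(u) ≥ 0 for all u and Σ_u π₀(u) = 1) and every vertex v, the sequence n ↦ Σ_u π₀(u)·(Pⁿ)(u,v) converges to π(v) = deg(v)/(2|E|) as n → ∞. -/

import Mathlib

/-- The simple random walk transition matrix of a finite simple graph:
`P u v = 1 / deg u` if `u` and `v` are adjacent, and `0` otherwise. -/
noncomputable def srwMatrix {V : Type*} [Fintype V] (G : SimpleGraph V)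
    [DecidableRel G.Adj] : Matrix V V ℝ :=
  fun u v => if G.Adj u v then (G.degree u : ℝ)⁻¹ else 0

open Matrix in
lemma stoch_tendsto {V : Type*} [Fintype V] [DecidableEq V] [Nonempty V] (P : Matrix V V ℝ)
    (hP : P ∈ rowStochastic ℝ V) (p : V → ℝ) (hp1 : ∑ v, p v = 1)
    (hpP : ∀ v, ∑ u, p u * P u v = p v) (hp0 : ∀ v, 0 ≤ p v) (N : ℕ) (hN0 : 0 < N)
    (hN : ∀ u v, 0 < (P ^ N) u v) (u v : V) :
    Filter.Tendsto (fun n : ℕ => (P ^ n) u v) Filter.atTop (nhds (p v)) := by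
  have hple : ∀ v, p v ≤ 1 := fun v => by
    rw [← hp1]; exact Finset.single_le_sum (fun i _ => hp0 i) (Finset.mem_univ v)
  have hPn : ∀ n, P ^ n ∈ rowStochastic ℝ V := fun n => Submonoid.pow_mem _ hP n
  have hpn : ∀ n v, ∑ u, p u * (P ^ n) u v = p v := by
    intro n
    have h1 : p ᵥ* P = p := funext hpP
    have h2 : p ᵥ* (P ^ n) = p := by
      induction n with
      | zero => simp
      | succ n ih => rw [pow_succ, ← Matrix.vecMul_vecMul, ih, h1]
    exact fun v => congrFun h2 v
  obtain ⟨⟨a, b⟩, hab⟩ := Finite.exists_min (fun x : V × V => (P ^ N) x.1 x.2)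
  set d := (P ^ N) a b with hd
  have hd0 : 0 < d := hN a b
  have hd1 : d ≤ 1 := le_one_of_mem_rowStochastic (hPn N)
  have hdm : ∀ u v, d * p v ≤ (P ^ N) u v := fun u v =>
    le_trans (by nlinarith [hple v, hp0 v]) (hab (u, v))
  set c := 1 - d with hc
  have hc0 : 0 ≤ c := by linarith
  have hc1 : c < 1 := by linarith
  have key : ∀ k u v, (1 - c ^ k) * p v ≤ ((P ^ N) ^ k) u v := by
    intro k
    induction k with
    | zero =>
      intro u v
      simp only [pow_zero, sub_self, zero_mul]
      exact nonneg_of_mem_rowStochastic (hPn 0)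
    | succ k ih =>
      intro u v
      rw [pow_succ' (P ^ N), Matrix.mul_apply]
      have h1 : ∑ w, d * p w * (((P ^ N) ^ k) w v - (1 - c ^ k) * p v)
          ≤ ∑ w, (P ^ N) u w * (((P ^ N) ^ k) w v - (1 - c ^ k) * p v) :=
        Finset.sum_le_sum fun w _ =>
          mul_le_mul_of_nonneg_right (hdm u w) (by linarith [ih w v])
      have h2 : ∑ w, d * p w * (((P ^ N) ^ k) w v - (1 - c ^ k) * p v)
          = d * (c ^ k * p v) := by
        simp only [mul_sub, Finset.sum_sub_distrib, mul_assoc]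
        simp only [← Finset.mul_sum, ← Finset.sum_mul, hp1, ← pow_mul, hpn]
        ring
      have h3 : ∑ w, (P ^ N) u w * (((P ^ N) ^ k) w v - (1 - c ^ k) * p v)
          = ∑ w, (P ^ N) u w * ((P ^ N) ^ k) w v - (1 - c ^ k) * p v := by
        simp only [mul_sub, Finset.sum_sub_distrib]
        rw [← Finset.sum_mul, sum_row_of_mem_rowStochastic (hPn N), one_mul]
      rw [h2, h3] at h1
      have : c ^ (k + 1) = c ^ k * (1 - d) := pow_succ _ _
      rw [this]
      linarith
  have low : ∀ n u v, (1 - c ^ (n / N)) * p v ≤ (P ^ n) u v := by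
    intro n u v
    have : P ^ n = P ^ (n % N) * (P ^ N) ^ (n / N) := by
      rw [← pow_mul, ← pow_add, Nat.mod_add_div]
    rw [this, Matrix.mul_apply]
    calc (1 - c ^ (n / N)) * p v
        = ∑ w, (P ^ (n % N)) u w * ((1 - c ^ (n / N)) * p v) := by
          rw [← Finset.sum_mul, sum_row_of_mem_rowStochastic (hPn _), one_mul]
      _ ≤ _ := Finset.sum_le_sum fun w _ =>
          mul_le_mul_of_nonneg_left (key _ w v) (nonneg_of_mem_rowStochastic (hPn _))
  have up : ∀ n, (P ^ n) u v ≤ 1 - (1 - c ^ (n / N)) * (1 - p v) := by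
    intro n
    have h1 := sum_row_of_mem_rowStochastic (hPn n) u
    rw [← Finset.add_sum_erase _ _ (Finset.mem_univ v)] at h1
    have h2 := hp1
    rw [← Finset.add_sum_erase _ _ (Finset.mem_univ v)] at h2
    have h3 : ∑ w ∈ Finset.univ.erase v, (1 - c ^ (n / N)) * p w
        ≤ ∑ w ∈ Finset.univ.erase v, (P ^ n) u w :=
      Finset.sum_le_sum fun w _ => low n u w
    rw [← Finset.mul_sum] at h3
    have h4 : ∑ w ∈ Finset.univ.erase v, p w = 1 - p v := by linarith
    rw [h4] at h3
    linarith
  have hlim : Filter.Tendsto (fun n : ℕ => c ^ (n / N)) Filter.atTop (nhds 0) :=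
    (tendsto_pow_atTop_nhds_zero_of_lt_one hc0 hc1).comp
      (Nat.tendsto_div_const_atTop hN0.ne')
  have l1 : Filter.Tendsto (fun n : ℕ => (1 - c ^ (n / N)) * p v) Filter.atTop
      (nhds (p v)) := by
    simpa using (hlim.const_sub 1).mul_const (p v)
  have l2 : Filter.Tendsto (fun n : ℕ => 1 - (1 - c ^ (n / N)) * (1 - p v)) Filter.atTop
      (nhds (p v)) := by
    simpa using ((hlim.const_sub 1).mul_const (1 - p v)).const_sub 1
  exact tendsto_of_tendsto_of_tendsto_of_le_of_le l1 l2 (fun n => low n u v) up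

lemma srw_stoch {V : Type*} [Fintype V] [DecidableEq V] (G : SimpleGraph V)
    [DecidableRel G.Adj] (hdeg : ∀ v : V, 0 < G.degree v) :
    srwMatrix G ∈ Matrix.rowStochastic ℝ V := by
  rw [Matrix.mem_rowStochastic_iff_sum]
  constructor
  · intro i j
    unfold srwMatrix
    split_ifs <;> positivity
  · intro i
    have := hdeg i
    simp only [srwMatrix]
    rw [← Finset.sum_filter, Finset.sum_const, ← SimpleGraph.neighborFinset_eq_filter,
      SimpleGraph.card_neighborFinset_eq_degree, nsmul_eq_mul]
    exact mul_inv_cancel₀ (by positivity)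

lemma srw_walk_pos {V : Type*} [Fintype V] [DecidableEq V] (G : SimpleGraph V)
    [DecidableRel G.Adj] (hdeg : ∀ v : V, 0 < G.degree v) {u v : V} (w : G.Walk u v) :
    0 < (srwMatrix G ^ w.length) u v := by
  induction w with
  | nil => simp
  | @cons a b c h w ih =>
    rw [SimpleGraph.Walk.length_cons, pow_succ', Matrix.mul_apply]
    refine Finset.sum_pos' (fun i _ => mul_nonneg
      (Matrix.nonneg_of_mem_rowStochastic (srw_stoch G hdeg))
      (Matrix.nonneg_of_mem_rowStochastic (Submonoid.pow_mem _ (srw_stoch G hdeg) _)))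
      ⟨b, Finset.mem_univ _, mul_pos ?_ ih⟩
    have := hdeg a
    simp only [srwMatrix, h, if_true]
    positivity

lemma walk_add_even {V : Type*} (G : SimpleGraph V) (hn : ∀ v, ∃ w, G.Adj v w) {u v : V}
    (w : G.Walk u v) (k : ℕ) : ∃ w' : G.Walk u v, w'.length = w.length + 2 * k := by
  induction k with
  | zero => exact ⟨w, rfl⟩
  | succ k ih =>
    obtain ⟨w', hw'⟩ := ih
    obtain ⟨x, hx⟩ := hn u
    exact ⟨.cons hx (.cons hx.symm w'), by simp [hw']; ring⟩

lemma walk_eventually {V : Type*} (G : SimpleGraph V) (hconn : G.Connected)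
    (hnonbip : ¬ G.Colorable 2) (hn : ∀ v, ∃ w, G.Adj v w) (u v : V) :
    ∃ N, ∀ n ≥ N, ∃ w : G.Walk u v, w.length = n := by
  rw [SimpleGraph.two_colorable_iff_forall_loop_even] at hnonbip
  push Not at hnonbip
  obtain ⟨r, c, hc⟩ := hnonbip
  obtain ⟨p⟩ := hconn.preconnected u r
  obtain ⟨q⟩ := hconn.preconnected r v
  refine ⟨p.length + c.length + q.length, fun n hnN => ?_⟩
  rcases Nat.even_or_odd (n - (p.length + q.length)) with ⟨k, hk⟩ | ⟨k, hk⟩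
  · obtain ⟨w, hw⟩ := walk_add_even G hn (p.append q) k
    exact ⟨w, by rw [hw, SimpleGraph.Walk.length_append]; omega⟩
  · have hc' : Odd c.length := by simpa using hc
    obtain ⟨j, hj⟩ := hc'
    obtain ⟨w, hw⟩ := walk_add_even G hn ((p.append c).append q) (k - j)
    exact ⟨w, by rw [hw, SimpleGraph.Walk.length_append, SimpleGraph.Walk.length_append]; omega⟩

/-- For a finite connected non-bipartite simple graph with at least one
edge (hence every vertex has positive degree), the simple random walk started from any
initial distribution converges to the degree-proportional distribution
`π(v) = deg(v) / (2|E|)`. -/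
theorem srw_tendsto_degree_proportional
    {V : Type*} [Fintype V] [DecidableEq V] (G : SimpleGraph V) [DecidableRel G.Adj]
    (hconn : G.Connected) (hnonbip : ¬ G.Colorable 2)
    (hE : 1 ≤ G.edgeFinset.card) (hdeg : ∀ v : V, 0 < G.degree v)
    (π₀ : V → ℝ) (hπ₀ : ∀ u, 0 ≤ π₀ u) (hπ₀sum : ∑ u, π₀ u = 1) (v : V) :
    Filter.Tendsto (fun n : ℕ => ∑ u, π₀ u * ((srwMatrix G) ^ n) u v)
      Filter.atTop
      (nhds ((G.degree v : ℝ) / (2 * (G.edgeFinset.card : ℝ)))) := by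
  have hn : ∀ v, ∃ w, G.Adj v w := fun v => (G.degree_pos_iff_exists_adj v).1 (hdeg v)
  have : Nonempty V := hconn.nonempty
  choose N hN using walk_eventually G hconn hnonbip hn
  set M : ℕ := (∑ a, ∑ b, N a b) + 1 with hM
  have hNM : ∀ a b, N a b ≤ M := fun a b => by
    have h1 : N a b ≤ ∑ b, N a b :=
      Finset.single_le_sum (f := fun b => N a b) (fun i _ => Nat.zero_le _) (Finset.mem_univ b)
    have h2 : ∑ b, N a b ≤ ∑ a, ∑ b, N a b :=
      Finset.single_le_sum (f := fun a => ∑ b, N a b) (fun i _ => Nat.zero_le _)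
        (Finset.mem_univ a)
    omega
  have hpos : ∀ a b, 0 < (srwMatrix G ^ M) a b := fun a b => by
    obtain ⟨w, hw⟩ := hN a b M (hNM a b)
    rw [← hw]
    exact srw_walk_pos G hdeg w
  have hE' : (0 : ℝ) < G.edgeFinset.card := by exact_mod_cast hE
  have hlim := stoch_tendsto (srwMatrix G) (srw_stoch G hdeg)
    (fun v => (G.degree v : ℝ) / (2 * (G.edgeFinset.card : ℝ)))
    (by
      rw [← Finset.sum_div, div_eq_one_iff_eq (by positivity)]
      exact_mod_cast G.sum_degrees_eq_twice_card_edges)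
    (by
      intro v
      have : ∀ u, (G.degree u : ℝ) / (2 * (G.edgeFinset.card : ℝ)) * srwMatrix G u v
          = if G.Adj v u then 1 / (2 * (G.edgeFinset.card : ℝ)) else 0 := by
        intro u
        have hu : (G.degree u : ℝ) ≠ 0 := by exact_mod_cast (hdeg u).ne'
        simp only [srwMatrix, G.adj_comm v u]
        split_ifs
        · field_simp
        · simp
      simp only [this]
      rw [← Finset.sum_filter, Finset.sum_const, ← SimpleGraph.neighborFinset_eq_filter,
        SimpleGraph.card_neighborFinset_eq_degree, nsmul_eq_mul]
      ring)
    (fun v => by positivity) M (by omega) hpos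
  have := tendsto_finsetSum Finset.univ (fun u _ => (hlim u v).const_mul (π₀ u))
  rwa [← Finset.sum_mul, hπ₀sum, one_mul] at this
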